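/- arXiv:2508.19712 — 4 statements merged into one kernel-verified Lean document; each statement's English description precedes it below -/
import Mathlib

section
/- Let B be a symmetric positive definite d×d real matrix, g ∈ ℝ^d, and θ, L > 0. Consider the model m(h) := ⟨g, h⟩ + (θ/2)‖h‖_B² + (L/3)‖h‖_B³ on ℝ^d. Then the equation L η² ‖g‖_B^* + θ η = 1 has a unique positive solution η, given explicitly by η = 2/(θ + √(θ² + 4L‖g‖_B^*)); this η satisfies 0 < η ≤ 1/θ; and the point h* := −η B⁻¹ g satisfies the first-order condition g + θ B h* + L‖h*‖_B B h* = 0 and is a global minimizer of m over ℝ^d. -/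
open scoped RealInnerProductSpace

/-- The action of a `d × d` matrix on a vector of `EuclideanSpace ℝ (Fin d)`. -/
noncomputable def mulV {d : ℕ} (B : Matrix (Fin d) (Fin d) ℝ)
    (v : EuclideanSpace ℝ (Fin d)) : EuclideanSpace ℝ (Fin d) :=
  (EuclideanSpace.equiv (Fin d) ℝ).symm (B.mulVec ((EuclideanSpace.equiv (Fin d) ℝ) v))

/-- The `B`-norm `‖h‖_B = ⟨h, B h⟩^{1/2}`. -/
noncomputable def normB {d : ℕ} (B : Matrix (Fin d) (Fin d) ℝ)
    (h : EuclideanSpace ℝ (Fin d)) : ℝ :=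
  Real.sqrt ⟪h, mulV B h⟫

/-- The dual norm `‖g‖_B^* = ⟨g, B⁻¹ g⟩^{1/2}`. -/
noncomputable def dualNormB {d : ℕ} (B : Matrix (Fin d) (Fin d) ℝ)
    (g : EuclideanSpace ℝ (Fin d)) : ℝ :=
  Real.sqrt ⟪g, mulV B⁻¹ g⟫

/-- The Hessian of `f` at `x`, as a `d × d` matrix (matrix of the Fréchet derivative
of the gradient). -/
noncomputable def hessM {d : ℕ} (f : EuclideanSpace ℝ (Fin d) → ℝ)
    (x : EuclideanSpace ℝ (Fin d)) : Matrix (Fin d) (Fin d) ℝ :=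
  fun i j => (fderiv ℝ (gradient f) x (EuclideanSpace.single j (1 : ℝ))) i

/-- `f` is semi-strongly self-concordant with constant `Ls`:
`‖(∇²f(y) − ∇²f(x)) h‖_{∇²f(x)}^* ≤ Ls ‖y − x‖_{∇²f(x)} ‖h‖_{∇²f(x)}` for all `x y h`. -/
def SemiStrongSelfConcordant {d : ℕ} (f : EuclideanSpace ℝ (Fin d) → ℝ) (Ls : ℝ) : Prop :=
  ∀ x y h : EuclideanSpace ℝ (Fin d),
    dualNormB (hessM f x) (mulV (hessM f y - hessM f x) h) ≤
      Ls * normB (hessM f x) (y - x) * normB (hessM f x) h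

/-- `Bx` is an `(al, au)`-relative inexact Hessian of `f` at `x`:
`Bx` is symmetric positive definite, `0 ≤ al ≤ 1`, `0 ≤ au`, and
`(1 − al) Bx ⪯ ∇²f(x) ⪯ (1 + au) Bx` in the Loewner order. -/
def RelInexactHessian {d : ℕ} (f : EuclideanSpace ℝ (Fin d) → ℝ)
    (x : EuclideanSpace ℝ (Fin d)) (al au : ℝ) (Bx : Matrix (Fin d) (Fin d) ℝ) : Prop :=
  0 ≤ al ∧ al ≤ 1 ∧ 0 ≤ au ∧ Bx.PosDef ∧
    (hessM f x - (1 - al) • Bx).PosSemidef ∧ ((1 + au) • Bx - hessM f x).PosSemidef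

/-- The inexact second-order model
`Q̄_f(y;x) = f(x) + ⟨∇f(x), y − x⟩ + ½⟨B_x(y − x), y − x⟩`. -/
noncomputable def Qbar {d : ℕ} (f : EuclideanSpace ℝ (Fin d) → ℝ)
    (Bx : Matrix (Fin d) (Fin d) ℝ) (x y : EuclideanSpace ℝ (Fin d)) : ℝ :=
  f x + ⟪gradient f x, y - x⟫ + (1 / 2) * ⟪mulV Bx (y - x), y - x⟫

lemma mulV_add' {d : ℕ} (B : Matrix (Fin d) (Fin d) ℝ) (x y : EuclideanSpace ℝ (Fin d)) :
    mulV B (x + y) = mulV B x + mulV B y := by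
  simp [mulV, Matrix.mulVec_add]

lemma mulV_smul' {d : ℕ} (B : Matrix (Fin d) (Fin d) ℝ) (c : ℝ) (x : EuclideanSpace ℝ (Fin d)) :
    mulV B (c • x) = c • mulV B x := by
  simp [mulV, Matrix.mulVec_smul]

lemma mulV_inv' {d : ℕ} (B : Matrix (Fin d) (Fin d) ℝ) (hB : B.PosDef)
    (x : EuclideanSpace ℝ (Fin d)) : mulV B (mulV B⁻¹ x) = x := by
  have h : IsUnit B.det := (Matrix.isUnit_iff_isUnit_det B).mp hB.isUnit
  have e : mulV B (mulV B⁻¹ x) =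
      WithLp.toLp 2 (B.mulVec (B⁻¹.mulVec (x : Fin d → ℝ))) := rfl
  rw [e, Matrix.mulVec_mulVec, Matrix.mul_nonsing_inv B h, Matrix.one_mulVec]

lemma inner_mulV' {d : ℕ} (B : Matrix (Fin d) (Fin d) ℝ) (x y : EuclideanSpace ℝ (Fin d)) :
    ⟪x, mulV B y⟫ = (x : Fin d → ℝ) ⬝ᵥ (B.mulVec (y : Fin d → ℝ)) := by
  have e : mulV B y = WithLp.toLp 2 (B.mulVec (y : Fin d → ℝ)) := rfl
  rw [e]
  simp [PiLp.inner_apply, dotProduct, mul_comm]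

lemma mulV_symm' {d : ℕ} (B : Matrix (Fin d) (Fin d) ℝ) (hB : B.PosDef)
    (x y : EuclideanSpace ℝ (Fin d)) : ⟪x, mulV B y⟫ = ⟪y, mulV B x⟫ := by
  have h : B.transpose = B := by simpa using hB.isHermitian.eq
  rw [inner_mulV', inner_mulV', Matrix.dotProduct_mulVec, ← Matrix.mulVec_transpose, h,
    dotProduct_comm]

lemma mulV_nonneg' {d : ℕ} (B : Matrix (Fin d) (Fin d) ℝ) (hB : B.PosDef)
    (x : EuclideanSpace ℝ (Fin d)) : 0 ≤ ⟪x, mulV B x⟫ := by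
  rw [inner_mulV']
  simpa using hB.posSemidef.dotProduct_mulVec_nonneg (x : Fin d → ℝ)

/-- existence/uniqueness and explicit formula for the CEQN stepsize, and the
corresponding point `h* = −η B⁻¹ g` satisfies the first-order condition and globally
minimizes the model `m(h) = ⟨g,h⟩ + (θ/2)‖h‖_B² + (L/3)‖h‖_B³`. -/
theorem stmt0 {d : ℕ} (B : Matrix (Fin d) (Fin d) ℝ) (hB : B.PosDef)
    (g : EuclideanSpace ℝ (Fin d)) (θ L : ℝ) (hθ : 0 < θ) (hL : 0 < L) :
    let m : EuclideanSpace ℝ (Fin d) → ℝ :=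
      fun h => ⟪g, h⟫ + θ / 2 * (normB B h) ^ 2 + L / 3 * (normB B h) ^ 3
    let η : ℝ := 2 / (θ + Real.sqrt (θ ^ 2 + 4 * L * dualNormB B g))
    let hstar : EuclideanSpace ℝ (Fin d) := -(η • mulV B⁻¹ g)
    (∃! e : ℝ, 0 < e ∧ L * e ^ 2 * dualNormB B g + θ * e = 1) ∧
    (0 < η ∧ L * η ^ 2 * dualNormB B g + θ * η = 1 ∧ η ≤ 1 / θ) ∧
    g + θ • mulV B hstar + (L * normB B hstar) • mulV B hstar = 0 ∧
    ∀ h : EuclideanSpace ℝ (Fin d), m hstar ≤ m h := by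
  intro m η hstar
  set G := dualNormB B g with hG
  set u := mulV B⁻¹ g with hu
  have hBu : mulV B u = g := mulV_inv' B hB g
  have hG0 : 0 ≤ G := Real.sqrt_nonneg _
  have hgu : ⟪g, u⟫ = ⟪u, mulV B u⟫ := by rw [hBu, real_inner_comm]
  have hG2 : G ^ 2 = ⟪g, u⟫ := by
    rw [hG, dualNormB, Real.sq_sqrt]
    rw [← hu, hgu]; exact mulV_nonneg' B hB u
  set S := Real.sqrt (θ ^ 2 + 4 * L * G) with hS
  have hS0 : 0 ≤ S := Real.sqrt_nonneg _
  have hS2 : S ^ 2 = θ ^ 2 + 4 * L * G := Real.sq_sqrt (by positivity)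
  have hSp : 0 < θ + S := by linarith
  have hηp : 0 < η := by positivity
  have hηS : η * (θ + S) = 2 := div_mul_cancel₀ _ hSp.ne'
  have heq : L * η ^ 2 * G + θ * η = 1 := by
    have h1 : 4 * L * G = S ^ 2 - θ ^ 2 := by linarith
    have h2 : η * S = 2 - η * θ := by linarith
    have h3 : η ^ 2 * S ^ 2 = (2 - η * θ) ^ 2 := by rw [← h2]; ring
    linear_combination (η ^ 2 / 4) * h1 + h3 / 4
  have hle : η ≤ 1 / θ := by
    rw [le_div_iff₀ hθ]
    have : 0 ≤ L * η ^ 2 * G := by positivity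
    linarith
  have hnn : ∀ x, normB B x ^ 2 = ⟪x, mulV B x⟫ := fun x =>
    Real.sq_sqrt (mulV_nonneg' B hB x)
  have hn0 : ∀ x, 0 ≤ normB B x := fun x => Real.sqrt_nonneg _
  have hst : hstar = (-η) • u := by simp [hstar, hu]
  have hBst : mulV B hstar = (-η) • g := by rw [hst, mulV_smul', hBu]
  have hns : normB B hstar = η * G := by
    have h1 : normB B hstar ^ 2 = (η * G) ^ 2 := by
      rw [hnn, hBst, hst, inner_smul_left, inner_smul_right, mul_pow, hG2,
        real_inner_comm u g]
      simp; ring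
    exact (pow_left_inj₀ (hn0 _) (by positivity) two_ne_zero).mp h1
  refine ⟨⟨η, ⟨hηp, heq⟩, ?_⟩, ⟨hηp, heq, hle⟩, ?_, ?_⟩
  · rintro e ⟨he, he1⟩
    have h1 : (e - η) * (L * G * (e + η) + θ) = 0 := by linear_combination he1 - heq
    have h2 : 0 < L * G * (e + η) + θ := by positivity
    rcases mul_eq_zero.mp h1 with h | h
    · linarith
    · linarith
  · rw [hns, hBst]
    have : g + θ • (-η) • g + (L * (η * G)) • (-η) • g
        = (1 - (L * η ^ 2 * G + θ * η)) • g := by module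
    rw [this, heq]; simp
  · intro h
    have hcs : ⟪g, h⟫ ^ 2 ≤ (G * normB B h) ^ 2 := by
      have hq : ∀ t : ℝ, 0 ≤ G ^ 2 * (t * t) + (2 * ⟪g, h⟫) * t + normB B h ^ 2 := by
        intro t
        have h0 := mulV_nonneg' B hB (h + t • u)
        have h1 : ⟪u, mulV B h⟫ = ⟪g, h⟫ := by
          rw [mulV_symm' B hB, hBu, real_inner_comm]
        rw [mulV_add', mulV_smul', hBu, inner_add_left, inner_add_right, inner_add_right,
          real_inner_smul_left, real_inner_smul_left, real_inner_smul_right,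
          real_inner_smul_right, h1, real_inner_comm g h, real_inner_comm g u, ← hG2,
          ← hnn] at h0
        linarith
      have hd := discrim_le_zero hq
      rw [discrim] at hd
      nlinarith
    have hcs' : -(G * normB B h) ≤ ⟪g, h⟫ :=
      (abs_le_of_sq_le_sq' hcs (mul_nonneg hG0 (hn0 h))).1
    have hgs : ⟪g, hstar⟫ = -η * G ^ 2 := by rw [hst, real_inner_smul_right, hG2]
    have hr := hn0 h
    show ⟪g, hstar⟫ + θ / 2 * (normB B hstar) ^ 2 + L / 3 * (normB B hstar) ^ 3 ≤
      ⟪g, h⟫ + θ / 2 * (normB B h) ^ 2 + L / 3 * (normB B h) ^ 3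
    rw [hns, hgs]
    set r := normB B h
    have hs0 : 0 ≤ η * G := by positivity
    have hGs : L * (η * G) ^ 2 + θ * (η * G) = G := by linear_combination G * heq
    have key : 0 ≤ θ / 2 * (r - η * G) ^ 2 + L / 3 * ((r - η * G) ^ 2 * (r + 2 * (η * G))) := by
      positivity
    have hid : (-(G * r) + θ / 2 * r ^ 2 + L / 3 * r ^ 3) -
        (-η * G ^ 2 + θ / 2 * (η * G) ^ 2 + L / 3 * (η * G) ^ 3) =
        θ / 2 * (r - η * G) ^ 2 + L / 3 * ((r - η * G) ^ 2 * (r + 2 * (η * G))) := by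
      linear_combination (r - η * G) * hGs
    linarith
end

section
/- Let f : ℝ^d → ℝ be convex, twice continuously differentiable with positive definite Hessian ∇²f(x) for every x, and semi-strongly self-concordant with constant L_semi > 0. Let x ∈ ℝ^d and let B_x be an (α̲, ᾱ)-relative inexact Hessian of f at x. Then for every y ∈ ℝ^d: Q̄_f(y;x) − f(y) ≤ (α̲/2)‖y − x‖_{B_x}² + ((1 + ᾱ)^{3/2} L_semi / 6)‖y − x‖_{B_x}³. -/
open scoped RealInnerProductSpace

theorem aux_ofLp {d : ℕ} (B : Matrix (Fin d) (Fin d) ℝ) (v : EuclideanSpace ℝ (Fin d)) :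
    (mulV B v).ofLp = B.mulVec v.ofLp := rfl

theorem aux_inner {d : ℕ} (B : Matrix (Fin d) (Fin d) ℝ) (u v : EuclideanSpace ℝ (Fin d)) :
    ⟪u, mulV B v⟫ = dotProduct u.ofLp (B.mulVec v.ofLp) := by
  simp [aux_ofLp, PiLp.inner_apply, dotProduct, mul_comm]

theorem aux_cs {d : ℕ} (A : Matrix (Fin d) (Fin d) ℝ) (hA : A.PosDef)
    (g h : EuclideanSpace ℝ (Fin d)) : |⟪h, g⟫| ≤ dualNormB A g * normB A h := by
  have hAu : mulV A (mulV A⁻¹ g) = g := by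
    have : IsUnit A.det := hA.det_pos.ne'.isUnit
    ext i
    simp [aux_ofLp, Matrix.mulVec_mulVec, Matrix.mul_nonsing_inv A this]
  have hnn : ∀ v, 0 ≤ ⟪v, mulV A v⟫ := by
    intro v
    rw [aux_inner]
    simpa using hA.posSemidef.dotProduct_mulVec_nonneg v.ofLp
  have hsymm : ∀ u v, ⟪u, mulV A v⟫ = ⟪v, mulV A u⟫ := by
    intro u v
    have hT : A.transpose = A := by simpa using hA.isHermitian.eq
    rw [aux_inner, aux_inner, Matrix.dotProduct_mulVec, dotProduct_comm,
      ← Matrix.mulVec_transpose, hT]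
  have hadd : ∀ u v, mulV A (u + v) = mulV A u + mulV A v := by
    intro u v; ext i; simp [mulV, Matrix.mulVec_add]
  have hsm : ∀ (s : ℝ) v, mulV A (s • v) = s • mulV A v := by
    intro s v; ext i; simp [mulV, Matrix.mulVec_smul]
  set u := mulV A⁻¹ g with hu
  have hgu : ⟪g, u⟫ = ⟪u, mulV A u⟫ := by rw [hAu, real_inner_comm]
  have hq : ∀ s : ℝ, 0 ≤ ⟪g, u⟫ * (s * s) + (2 * ⟪h, g⟫) * s + ⟪h, mulV A h⟫ := by
    intro s
    have h1 := hnn (h + s • u)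
    have h2 := hsymm u h
    rw [hAu] at h2
    rw [hadd, hsm, hAu, inner_add_left, inner_add_right, inner_add_right, inner_smul_left,
      inner_smul_left, inner_smul_right, inner_smul_right, h2, real_inner_comm g u] at h1
    simp only [conj_trivial] at h1
    linarith
  have hd := discrim_le_zero hq
  unfold discrim at hd
  unfold dualNormB normB
  rw [← Real.sqrt_mul (by rw [← hu, hgu]; exact hnn u)]
  apply Real.abs_le_sqrt
  rw [← hu]
  nlinarith

theorem aux_hess {d : ℕ} (f : EuclideanSpace ℝ (Fin d) → ℝ) (x h : EuclideanSpace ℝ (Fin d)) :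
    fderiv ℝ (gradient f) x h = mulV (hessM f x) h := by
  have hh : h = ∑ j, h j • EuclideanSpace.single j (1 : ℝ) := by
    ext i
    simp [Finset.sum_apply, Pi.single_apply]
  ext i
  conv_lhs => rw [hh]
  simp [mulV, hessM, Matrix.mulVec, dotProduct, mul_comm]

theorem aux_taylor (φ φ1 φ2 : ℝ → ℝ) (a c : ℝ) (h1 : ∀ t, HasDerivAt φ (φ1 t) t)
    (h2 : ∀ t, HasDerivAt φ1 (φ2 t) t) (hb : ∀ t, 0 ≤ t → a - c * t ≤ φ2 t) :
    φ 0 + φ1 0 + a / 2 - c / 6 ≤ φ 1 := by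
  have key : ∀ (g g' : ℝ → ℝ), (∀ t, HasDerivAt g (g' t) t) → (∀ t, 0 ≤ t → 0 ≤ g' t) →
      ∀ t, 0 ≤ t → g 0 ≤ g t := by
    intro g g' hg hg' t ht
    refine monotoneOn_of_deriv_nonneg (convex_Ici 0)
      (fun s _ => (hg s).continuousAt.continuousWithinAt)
      (fun s _ => (hg s).differentiableAt.differentiableWithinAt) ?_
      Set.self_mem_Ici ht ht
    intro s hs
    rw [interior_Ici] at hs
    rw [(hg s).deriv]
    exact hg' s (le_of_lt hs)
  have k1 : ∀ t, 0 ≤ t → φ1 0 ≤ φ1 t - a * t + c * t ^ 2 / 2 := by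
    intro t ht
    have := key (fun t => φ1 t - a * t + c * t ^ 2 / 2) (fun t => φ2 t - a + c * t) (by
      intro t
      have := ((h2 t).sub ((hasDerivAt_id t).const_mul a)).add
        ((((hasDerivAt_id t).pow 2).const_mul c).div_const 2)
      refine this.congr_deriv ?_
      simp; ring) (fun t ht => by linarith [hb t ht]) t ht
    simpa using this
  have := key (fun t => φ t - φ1 0 * t - a * t ^ 2 / 2 + c * t ^ 3 / 6)
    (fun t => φ1 t - φ1 0 - a * t + c * t ^ 2 / 2) (by
      intro t
      have := (((h1 t).sub ((hasDerivAt_id t).const_mul (φ1 0))).sub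
        ((((hasDerivAt_id t).pow 2).const_mul a).div_const 2)).add
        ((((hasDerivAt_id t).pow 3).const_mul c).div_const 6)
      refine this.congr_deriv ?_
      simp; ring) (fun t ht => by linarith [k1 t ht]) 1 zero_le_one
  norm_num at this
  linarith

/-- upper bound on `Q̄_f(y;x) − f(y)` under semi-strong self-concordance and
relative Hessian inexactness. -/
theorem stmt2 {d : ℕ} (f : EuclideanSpace ℝ (Fin d) → ℝ)
    (hconv : ConvexOn ℝ Set.univ f) (hC2 : ContDiff ℝ 2 f)
    (hpd : ∀ x, (hessM f x).PosDef)
    (Ls : ℝ) (hLs : 0 < Ls) (hssc : SemiStrongSelfConcordant f Ls)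
    (x : EuclideanSpace ℝ (Fin d)) (al au : ℝ) (Bx : Matrix (Fin d) (Fin d) ℝ)
    (hrel : RelInexactHessian f x al au Bx) :
    ∀ y : EuclideanSpace ℝ (Fin d),
      Qbar f Bx x y - f y ≤
        al / 2 * (normB Bx (y - x)) ^ 2 +
          (1 + au) ^ ((3 : ℝ) / 2) * Ls / 6 * (normB Bx (y - x)) ^ 3 := by
  intro y
  obtain ⟨hal, hal1, hau, hB, hlo, hup⟩ := hrel
  obtain ⟨h, rfl⟩ : ∃ h, y = x + h := ⟨y - x, by simp⟩
  simp only [Qbar, add_sub_cancel_left]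
  have hnn : ∀ (A : Matrix (Fin d) (Fin d) ℝ), A.PosSemidef → 0 ≤ ⟪h, mulV A h⟫ := by
    intro A hA
    rw [aux_inner]
    simpa using hA.dotProduct_mulVec_nonneg h.ofLp
  have hN2 : normB (hessM f x) h ^ 2 = ⟪h, mulV (hessM f x) h⟫ :=
    Real.sq_sqrt (hnn _ (hpd x).posSemidef)
  have hb2 : normB Bx h ^ 2 = ⟪h, mulV Bx h⟫ := Real.sq_sqrt (hnn _ hB.posSemidef)
  have hN0 : 0 ≤ normB (hessM f x) h := Real.sqrt_nonneg _
  have hb0 : 0 ≤ normB Bx h := Real.sqrt_nonneg _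
  have hlo' := hnn _ hlo
  have hup' := hnn _ hup
  rw [aux_inner, Matrix.sub_mulVec, dotProduct_sub, Matrix.smul_mulVec, dotProduct_smul,
    ← aux_inner, ← aux_inner, ← hN2, ← hb2, smul_eq_mul] at hlo' hup'
  have hgC : ContDiff ℝ 1 (gradient f) := by
    have : ContDiff ℝ 1 (fderiv ℝ f) := hC2.fderiv_right (by norm_num)
    exact (InnerProductSpace.toDual ℝ (EuclideanSpace ℝ (Fin d))).symm.contDiff.comp this
  have hfd : Differentiable ℝ f := hC2.differentiable (by norm_num)
  have hgd : Differentiable ℝ (gradient f) := hgC.differentiable (by norm_num)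
  have hline : ∀ t : ℝ, HasDerivAt (fun t : ℝ => x + t • h) h t := by
    intro t
    simpa using ((hasDerivAt_id t).smul_const h).const_add x
  have hT := aux_taylor (fun t => f (x + t • h)) (fun t => ⟪gradient f (x + t • h), h⟫)
    (fun t => ⟪h, mulV (hessM f (x + t • h)) h⟫) (normB (hessM f x) h ^ 2)
    (Ls * normB (hessM f x) h ^ 3)
    (by
      intro t
      have := (hfd (x + t • h)).hasGradientAt.hasFDerivAt.comp_hasDerivAt t (hline t)
      refine HasDerivAt.congr_deriv (f := fun t => f (x + t • h)) this ?_
      simp)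
    (by
      intro t
      have := (hgd (x + t • h)).hasFDerivAt.comp_hasDerivAt t (hline t)
      have := this.inner ℝ (hasDerivAt_const t h)
      rw [aux_hess] at this
      simpa [real_inner_comm] using this)
    (by
      intro t ht
      have h1 := hssc x (x + t • h) h
      have h2 := aux_cs _ (hpd x) (mulV (hessM f (x + t • h) - hessM f x) h) h
      have h3 : ⟪h, mulV (hessM f (x + t • h) - hessM f x) h⟫ =
          ⟪h, mulV (hessM f (x + t • h)) h⟫ - ⟪h, mulV (hessM f x) h⟫ := by
        simp only [aux_inner, Matrix.sub_mulVec, dotProduct_sub]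
      have h4 : normB (hessM f x) (x + t • h - x) = t * normB (hessM f x) h := by
        rw [add_sub_cancel_left]
        unfold normB
        rw [show ⟪t • h, mulV (hessM f x) (t • h)⟫ = t ^ 2 * ⟪h, mulV (hessM f x) h⟫ by
          simp only [aux_inner, WithLp.ofLp_smul, Matrix.mulVec_smul, dotProduct_smul,
            smul_dotProduct, smul_eq_mul]
          ring, Real.sqrt_mul (sq_nonneg t), Real.sqrt_sq ht]
      rw [h3] at h2
      rw [h4] at h1
      have h5 := mul_le_mul_of_nonneg_right h1 hN0
      have h6 := (abs_le.1 (h2.trans h5)).1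
      rw [← hN2] at h6
      linarith)
  simp only [zero_smul, add_zero, one_smul] at hT
  have hle : normB (hessM f x) h ≤ Real.sqrt (1 + au) * normB Bx h := by
    rw [← Real.sqrt_sq hb0, ← Real.sqrt_mul (by linarith)]
    exact Real.le_sqrt_of_sq_le (by linarith)
  have hle3 := pow_le_pow_left₀ hN0 hle 3
  have hpow : Real.sqrt (1 + au) ^ 3 = (1 + au) ^ ((3 : ℝ) / 2) := by
    rw [Real.sqrt_eq_rpow, ← Real.rpow_natCast, ← Real.rpow_mul (by linarith)]
    norm_num
  rw [mul_pow, hpow] at hle3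
  have hle4 := mul_le_mul_of_nonneg_left hle3 hLs.le
  rw [real_inner_comm, ← hb2] at *
  nlinarith
end

section
/- Let f : ℝ^d → ℝ be convex, twice continuously differentiable with positive definite Hessian everywhere, semi-strongly self-concordant with constant L_semi > 0, and let x* be a global minimizer of f. Let L ≥ (1 + ᾱ)^{3/2} L_semi, and for each j ≥ 0 let B_j be an (α̲, ᾱ)-relative inexact Hessian of f at x_j, let α_j > 0 satisfy α_j ≥ max(α̲, ᾱ), and generate iterates by the CEQN step with θ_j := 1 + α_j: x_{j+1} := x_j − η_j B_j⁻¹ ∇f(x_j), where η_j is the unique positive solution of L η_j² ‖∇f(x_j)‖_{B_j}^* + θ_j η_j = 1. Let k ≥ 1, suppose the inexactness is controlled so that α_j ≤ L ‖x_{j+1} − x_j‖_{B_j} for all j ∈ {0, …, k}, and let D̄ > 0 satisfy ‖x_j − x*‖_{B_j} + ‖∇f(x_j)‖_{B_j}^* ≤ D̄ for all j ∈ {0, …, k+1}. Then f(x_{k+1}) − f(x*) ≤ 486 L D̄³ / k². -/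
open scoped RealInnerProductSpace

namespace CEQN
variable {d : ℕ}

lemma mulV_apply (B : Matrix (Fin d) (Fin d) ℝ) (v : EuclideanSpace ℝ (Fin d)) :
    mulV B v = Matrix.toEuclideanLin B v := by
  rfl

lemma mulV_add (B : Matrix (Fin d) (Fin d) ℝ) (u v : EuclideanSpace ℝ (Fin d)) :
    mulV B (u + v) = mulV B u + mulV B v := by
  simp only [mulV_apply, map_add]

lemma mulV_sub (B : Matrix (Fin d) (Fin d) ℝ) (u v : EuclideanSpace ℝ (Fin d)) :
    mulV B (u - v) = mulV B u - mulV B v := by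
  simp only [mulV_apply, map_sub]

lemma mulV_smul (B : Matrix (Fin d) (Fin d) ℝ) (c : ℝ) (v : EuclideanSpace ℝ (Fin d)) :
    mulV B (c • v) = c • mulV B v := by
  simp only [mulV_apply, map_smul]

lemma sub_mulV (A B : Matrix (Fin d) (Fin d) ℝ) (v : EuclideanSpace ℝ (Fin d)) :
    mulV (A - B) v = mulV A v - mulV B v := by
  simp only [mulV_apply, map_sub, LinearMap.sub_apply]

lemma smul_mulV (A : Matrix (Fin d) (Fin d) ℝ) (c : ℝ) (v : EuclideanSpace ℝ (Fin d)) :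
    mulV (c • A) v = c • mulV A v := by
  simp only [mulV_apply, map_smul, LinearMap.smul_apply]

lemma mulV_inv {B : Matrix (Fin d) (Fin d) ℝ} (hB : B.PosDef) (v : EuclideanSpace ℝ (Fin d)) :
    mulV B (mulV B⁻¹ v) = v := by
  have h : IsUnit B.det := (Matrix.isUnit_iff_isUnit_det B).mp hB.isUnit
  have h2 : B.mulVec (B⁻¹.mulVec v.ofLp) = v.ofLp := by
    rw [Matrix.mulVec_mulVec, Matrix.mul_nonsing_inv B h, Matrix.one_mulVec]
  exact congrArg (WithLp.toLp 2) h2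

lemma inner_symm {B : Matrix (Fin d) (Fin d) ℝ} (hB : B.IsHermitian)
    (u v : EuclideanSpace ℝ (Fin d)) : ⟪u, mulV B v⟫ = ⟪mulV B u, v⟫ := by
  have := Matrix.isSymmetric_toEuclideanLin_iff.mpr hB
  exact (this u v).symm

lemma inner_nonneg {B : Matrix (Fin d) (Fin d) ℝ} (hB : B.PosSemidef)
    (u : EuclideanSpace ℝ (Fin d)) : 0 ≤ ⟪u, mulV B u⟫ := by
  have := hB.dotProduct_mulVec_nonneg u.ofLp
  rw [EuclideanSpace.inner_eq_star_dotProduct, dotProduct_comm]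
  exact this

lemma normB_sq {B : Matrix (Fin d) (Fin d) ℝ} (hB : B.PosDef)
    (u : EuclideanSpace ℝ (Fin d)) : normB B u ^ 2 = ⟪u, mulV B u⟫ :=
  Real.sq_sqrt (inner_nonneg hB.posSemidef u)

lemma normB_nonneg (B : Matrix (Fin d) (Fin d) ℝ)
    (u : EuclideanSpace ℝ (Fin d)) : 0 ≤ normB B u := Real.sqrt_nonneg _

lemma dual_eq {B : Matrix (Fin d) (Fin d) ℝ} (hB : B.PosDef)
    (v : EuclideanSpace ℝ (Fin d)) : dualNormB B v = normB B (mulV B⁻¹ v) := by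
  unfold dualNormB normB
  rw [mulV_inv hB, real_inner_comm]

/-- Cauchy-Schwarz in the B-norm -/
lemma cs {B : Matrix (Fin d) (Fin d) ℝ} (hB : B.PosDef)
    (u v : EuclideanSpace ℝ (Fin d)) : |⟪u, mulV B v⟫| ≤ normB B u * normB B v := by
  have key : ∀ t : ℝ, 0 ≤ ⟪v, mulV B v⟫ * (t * t) + 2 * ⟪u, mulV B v⟫ * t + ⟪u, mulV B u⟫ := by
    intro t
    have h := inner_nonneg hB.posSemidef (u + t • v)
    have h2 : ⟪v, mulV B u⟫ = ⟪u, mulV B v⟫ := by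
      rw [inner_symm hB.isHermitian, real_inner_comm]
    rw [mulV_add, mulV_smul] at h
    simp only [inner_add_left, inner_add_right, inner_smul_left, inner_smul_right, h2] at h
    simp at h
    linarith
  have hd := discrim_le_zero key
  unfold discrim at hd
  rw [← normB_sq hB, ← normB_sq hB] at hd
  apply abs_le_of_sq_le_sq _ (mul_nonneg (normB_nonneg _ _) (normB_nonneg _ _))
  nlinarith

lemma cs_dual {B : Matrix (Fin d) (Fin d) ℝ} (hB : B.PosDef)
    (u v : EuclideanSpace ℝ (Fin d)) : |⟪u, v⟫| ≤ normB B u * dualNormB B v := by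
  have := cs hB u (mulV B⁻¹ v)
  rwa [mulV_inv hB, ← dual_eq hB] at this

lemma normB_smul (B : Matrix (Fin d) (Fin d) ℝ) (c : ℝ)
    (u : EuclideanSpace ℝ (Fin d)) : normB B (c • u) = |c| * normB B u := by
  unfold normB
  rw [mulV_smul, inner_smul_left, inner_smul_right, ← Real.sqrt_sq_eq_abs, ← Real.sqrt_mul (sq_nonneg c)]
  congr 1
  simp; ring

lemma hess_mulV (f : EuclideanSpace ℝ (Fin d) → ℝ) (x h : EuclideanSpace ℝ (Fin d)) :
    mulV (hessM f x) h = fderiv ℝ (gradient f) x h := by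
  have : Matrix.toEuclideanLin (hessM f x) = (fderiv ℝ (gradient f) x).toLinearMap := by
    apply (EuclideanSpace.basisFun (Fin d) ℝ).toBasis.ext
    intro j
    ext i
    simp [hessM, Matrix.toEuclideanLin]
  rw [mulV_apply, this]; rfl

lemma taylor1 (p p' p'' : ℝ → ℝ) (M : ℝ) (h1 : ∀ t, HasDerivAt p (p' t) t)
    (h2 : ∀ t, HasDerivAt p' (p'' t) t) (h3 : ∀ t, 0 ≤ t → p'' t ≤ p'' 0 + M * t) :
    p 1 ≤ p 0 + p' 0 + p'' 0 / 2 + M / 6 := by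
  have a1 : ∀ t, 0 ≤ t → p' t ≤ p' 0 + p'' 0 * t + M * t ^ 2 / 2 := by
    have hd : ∀ t, HasDerivAt (fun t => p' 0 + p'' 0 * t + M * t ^ 2 / 2 - p' t)
        (p'' 0 + M * t - p'' t) t := by
      intro t
      have := ((((hasDerivAt_id t).const_mul (p'' 0)).const_add (p' 0)).add
        ((((hasDerivAt_id t).pow 2).const_mul M).div_const 2)).sub (h2 t)
      exact this.congr_deriv (by simp; ring)
    have hm : MonotoneOn (fun t => p' 0 + p'' 0 * t + M * t ^ 2 / 2 - p' t) (Set.Ici 0) := by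
      apply monotoneOn_of_deriv_nonneg (convex_Ici 0)
      · exact fun t _ => (hd t).continuousAt.continuousWithinAt
      · exact fun t _ => (hd t).differentiableAt.differentiableWithinAt
      · intro t ht
        rw [interior_Ici] at ht
        rw [(hd t).deriv]
        linarith [h3 t (le_of_lt ht)]
    intro t ht
    have := hm (Set.mem_Ici.2 le_rfl) (Set.mem_Ici.2 ht) ht
    simp at this
    linarith
  have hd : ∀ t, HasDerivAt (fun t => p' 0 * t + p'' 0 * t ^ 2 / 2 + M * t ^ 3 / 6 - p t)
      (p' 0 + p'' 0 * t + M * t ^ 2 / 2 - p' t) t := by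
    intro t
    have := ((((hasDerivAt_id t).const_mul (p' 0)).add
      ((((hasDerivAt_id t).pow 2).const_mul (p'' 0)).div_const 2)).add
      ((((hasDerivAt_id t).pow 3).const_mul M).div_const 6)).sub (h1 t)
    exact this.congr_deriv (by simp; ring)
  have hm : MonotoneOn (fun t => p' 0 * t + p'' 0 * t ^ 2 / 2 + M * t ^ 3 / 6 - p t) (Set.Ici 0) := by
    apply monotoneOn_of_deriv_nonneg (convex_Ici 0)
    · exact fun t _ => (hd t).continuousAt.continuousWithinAt
    · exact fun t _ => (hd t).differentiableAt.differentiableWithinAt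
    · intro t ht
      rw [interior_Ici] at ht
      rw [(hd t).deriv]
      linarith [a1 t (le_of_lt ht)]
  have := hm (Set.mem_Ici.2 le_rfl) (Set.mem_Ici.2 zero_le_one) zero_le_one
  simp at this
  linarith

lemma taylor_f (f : EuclideanSpace ℝ (Fin d) → ℝ) (hC2 : ContDiff ℝ 2 f)
    (hpd : ∀ x, (hessM f x).PosDef) (Ls : ℝ) (hssc : SemiStrongSelfConcordant f Ls)
    (x h : EuclideanSpace ℝ (Fin d)) :
    |f (x + h) - f x - ⟪gradient f x, h⟫ - ⟪h, mulV (hessM f x) h⟫ / 2| ≤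
      Ls * normB (hessM f x) h ^ 3 / 6 := by
  have hdiff : Differentiable ℝ f := hC2.differentiable (by norm_num)
  have hg : Differentiable ℝ (gradient f) := by
    have h1 : ContDiff ℝ 1 (fderiv ℝ f) := hC2.fderiv_right (by norm_num)
    have h2 : Differentiable ℝ (fderiv ℝ f) := h1.differentiable (by norm_num)
    exact ((InnerProductSpace.toDual ℝ (EuclideanSpace ℝ (Fin d))).symm.toContinuousLinearEquiv.differentiable).comp h2
  have hl : ∀ t : ℝ, HasDerivAt (fun t : ℝ => x + t • h) h t := by
    intro t
    simpa using ((hasDerivAt_id t).smul_const h).const_add x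
  have h1 : ∀ t : ℝ, HasDerivAt (fun t : ℝ => f (x + t • h)) ⟪gradient f (x + t • h), h⟫ t := by
    intro t
    have := (hdiff (x + t • h)).hasGradientAt.hasFDerivAt.comp_hasDerivAt t (hl t)
    exact this.congr_deriv (by simp)
  have h2 : ∀ t : ℝ, HasDerivAt (fun t : ℝ => ⟪gradient f (x + t • h), h⟫)
      ⟪h, mulV (hessM f (x + t • h)) h⟫ t := by
    intro t
    have h0 := (hg (x + t • h)).hasFDerivAt.comp_hasDerivAt t (hl t)
    have := h0.inner ℝ (hasDerivAt_const t h)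
    rw [hess_mulV, real_inner_comm]
    simpa using this
  have h3 : ∀ t : ℝ, 0 ≤ t → |⟪h, mulV (hessM f (x + t • h)) h⟫ - ⟪h, mulV (hessM f x) h⟫| ≤
      Ls * normB (hessM f x) h ^ 3 * t := by
    intro t ht
    rw [← inner_sub_right, ← sub_mulV]
    refine (cs_dual (hpd x) _ _).trans ?_
    have := hssc x (x + t • h) h
    rw [add_sub_cancel_left, normB_smul, abs_of_nonneg ht] at this
    calc _ ≤ _ := mul_le_mul_of_nonneg_left this (normB_nonneg _ _)
      _ = _ := by ring
  have u := taylor1 _ _ _ (Ls * normB (hessM f x) h ^ 3) h1 h2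
    (fun t ht => by
      have := (abs_le.1 (h3 t ht)).2
      simp only [zero_smul, add_zero]; linarith)
  have l := taylor1 _ _ _ (Ls * normB (hessM f x) h ^ 3) (fun t => (h1 t).neg) (fun t => (h2 t).neg)
    (fun t ht => by
      have := (abs_le.1 (h3 t ht)).1
      simp only [zero_smul, add_zero]; linarith)
  simp only [zero_smul, add_zero, one_smul, Pi.neg_apply] at u l
  rw [abs_le]
  constructor <;> linarith

/-- model bounds with the inexact Hessian -/
lemma model (f : EuclideanSpace ℝ (Fin d) → ℝ) (hC2 : ContDiff ℝ 2 f)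
    (hpd : ∀ x, (hessM f x).PosDef) (Ls : ℝ) (hLs : 0 < Ls) (hssc : SemiStrongSelfConcordant f Ls)
    (al au L : ℝ) (hL : (1 + au) ^ ((3 : ℝ) / 2) * Ls ≤ L)
    (x h : EuclideanSpace ℝ (Fin d)) (B : Matrix (Fin d) (Fin d) ℝ)
    (hr : RelInexactHessian f x al au B) :
    f (x + h) ≤ f x + ⟪gradient f x, h⟫ + (1 + au) / 2 * normB B h ^ 2 + L / 6 * normB B h ^ 3 ∧
    f x + ⟪gradient f x, h⟫ + (1 - al) / 2 * normB B h ^ 2 - L / 6 * normB B h ^ 3 ≤ f (x + h) := by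
  obtain ⟨h0, h1, h2, hB, hlo, hup⟩ := hr
  have T := abs_le.1 (taylor_f f hC2 hpd Ls hssc x h)
  have lo := inner_nonneg hlo h
  have up := inner_nonneg hup h
  rw [sub_mulV, smul_mulV, inner_sub_right, inner_smul_right, ← normB_sq hB] at lo up
  have hH : normB (hessM f x) h ≤ √(1 + au) * normB B h := by
    refine (sq_le_sq₀ (normB_nonneg _ _) (by have := normB_nonneg B h; positivity)).1 ?_
    rw [normB_sq (hpd x), mul_pow, Real.sq_sqrt (by linarith)]
    linarith
  have hc : (1 + au) ^ ((3 : ℝ) / 2) = √(1 + au) ^ 3 := by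
    rw [Real.sqrt_eq_rpow, ← Real.rpow_natCast, ← Real.rpow_mul (by linarith)]
    norm_num
  have h3 : Ls * normB (hessM f x) h ^ 3 ≤ L * normB B h ^ 3 := by
    calc _ ≤ Ls * (√(1 + au) * normB B h) ^ 3 := by
          have := normB_nonneg (hessM f x) h
          gcongr
      _ = ((1 + au) ^ ((3 : ℝ) / 2) * Ls) * normB B h ^ 3 := by rw [hc]; ring
      _ ≤ _ := by
          have := normB_nonneg B h
          gcongr
  constructor <;> linarith [T.1, T.2]

/-- one step inequalities -/
lemma step (f : EuclideanSpace ℝ (Fin d) → ℝ) (hC2 : ContDiff ℝ 2 f)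
    (hconv : ConvexOn ℝ Set.univ f)
    (hpd : ∀ x, (hessM f x).PosDef) (Ls : ℝ) (hLs : 0 < Ls) (hssc : SemiStrongSelfConcordant f Ls)
    (al au L : ℝ) (hL : (1 + au) ^ ((3 : ℝ) / 2) * Ls ≤ L) (hL0 : 0 ≤ L)
    (x xs x' : EuclideanSpace ℝ (Fin d)) (B : Matrix (Fin d) (Fin d) ℝ)
    (hr : RelInexactHessian f x al au B) (α η : ℝ) (hα : 0 < α ∧ max al au ≤ α)
    (hη : 0 < η ∧ L * η ^ 2 * dualNormB B (gradient f x) + (1 + α) * η = 1)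
    (hstep : x' = x - η • mulV B⁻¹ (gradient f x))
    (hctrl : α ≤ L * normB B (x' - x)) (D : ℝ)
    (hD : normB B (x - xs) + dualNormB B (gradient f x) ≤ D) :
    ∃ r, 0 ≤ r ∧ r ≤ D ∧ f x' ≤ f x - 5 / 6 * (L * r ^ 3) ∧
      ∀ t, 0 ≤ t → t ≤ 1 → f x' ≤ (1 - t) * f x + t * f xs + L * r * (t * D) ^ 2
        + L / 2 * (t * D) ^ 3 := by
  have hB := hr.2.2.2.1
  obtain ⟨ha0, ha⟩ := hα
  have hal : al ≤ α := (le_max_left _ _).trans ha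
  have hau : au ≤ α := (le_max_right _ _).trans ha
  obtain ⟨hη0, hη⟩ := hη
  set g := gradient f x with hg
  set h := x' - x with hh
  have hh' : h = -(η • mulV B⁻¹ g) := by rw [hh, hstep]; abel
  have hx' : x' = x + h := by rw [hh]; abel
  set r := normB B h with hrdef
  have hr0 : 0 ≤ r := normB_nonneg _ _
  have hr_eq : r = η * dualNormB B g := by
    rw [hrdef, hh', ← neg_smul, normB_smul, abs_neg, abs_of_pos hη0, dual_eq hB]
  have hη2 : η * (1 + α + L * r) = 1 := by rw [hr_eq]; linarith
  have hBh : mulV B h = -(η • g) := by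
    rw [hh', ← neg_smul, mulV_smul, mulV_inv hB, neg_smul]
  have hgB : g = -((1 + α + L * r) • mulV B h) := by
    rw [hBh, smul_neg, neg_neg, smul_smul, mul_comm, hη2, one_smul]
  have hdn : 0 ≤ dualNormB B g := Real.sqrt_nonneg _
  have hR0 := normB_nonneg B (x - xs)
  have hD0 : 0 ≤ D := by linarith
  have hLr : 0 ≤ L * r := mul_nonneg hL0 hr0
  have hη1 : η ≤ 1 := by nlinarith
  have hrD : r ≤ D := by
    rw [hr_eq]; nlinarith
  have hig : ∀ e, ⟪g, e⟫ = -((1 + α + L * r) * ⟪e, mulV B h⟫) := by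
    intro e
    conv_lhs => rw [hgB]
    rw [inner_neg_left, inner_smul_left, real_inner_comm]; simp
  have desc : f x' ≤ f x - 1 / 2 * r ^ 2 * (1 + α) - 5 / 6 * (L * r ^ 3) := by
    have := (model f hC2 hpd Ls hLs hssc al au L hL x h B hr).1
    rw [← hx', ← hg, hig, ← normB_sq hB, ← hrdef] at this
    nlinarith [mul_nonneg (sub_nonneg.2 hau) (sq_nonneg r)]
  refine ⟨r, hr0, hrD, ?_, ?_⟩
  · nlinarith [sq_nonneg r]
  intro t ht0 ht1
  set e := t • (xs - x) with he
  have hρ : normB B e = t * normB B (x - xs) := by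
    rw [he, ← neg_sub, smul_neg, ← neg_smul, normB_smul, abs_neg, abs_of_nonneg ht0]
  have hρD : normB B e ≤ t * D := by
    rw [hρ]; exact mul_le_mul_of_nonneg_left (by linarith) ht0
  have hρ0 := normB_nonneg B e
  have lo := (model f hC2 hpd Ls hLs hssc al au L hL x e B hr).2
  rw [← hg, hig] at lo
  have hcs := (abs_le.1 (cs hB e h)).2
  have hcv : f (x + e) ≤ (1 - t) * f x + t * f xs := by
    have := hconv.2 (Set.mem_univ x) (Set.mem_univ xs) (sub_nonneg.2 ht1) ht0 (by ring)
    simp only [smul_eq_mul] at this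
    have e2 : x + e = (1 - t) • x + t • xs := by rw [he]; module
    rw [e2]; exact this
  rw [← hrdef] at hcs
  set ρ := normB B e with hρdef
  have hm : (1 + α + L * r) * ⟪e, mulV B h⟫ ≤ (1 + α + L * r) * (ρ * r) :=
    mul_le_mul_of_nonneg_left hcs (by linarith)
  have q1 : 0 ≤ (1 + α) * (ρ - r) ^ 2 := by positivity
  have q2 : 0 ≤ L * ((ρ - r) ^ 2 * (ρ + 2 * r)) := by positivity
  have q3 : 0 ≤ (α - al) * ρ ^ 2 := mul_nonneg (by linarith) (by positivity)
  have q4 : 0 ≤ L * r ^ 3 := by positivity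
  have q5 : α * ρ ^ 2 ≤ L * r * (t * D) ^ 2 := by gcongr
  have q6 : L / 2 * ρ ^ 3 ≤ L / 2 * (t * D) ^ 3 := by gcongr
  clear_value ρ r
  generalize ⟪e, mulV B h⟫ = w at *
  linarith

lemma comb (a b s L r D t : ℝ) (hL : 0 ≤ L) (hr : 0 ≤ r) (hD : 0 ≤ D) (ht : 0 ≤ t)
    (h1 : b ≤ a - 5 / 6 * (L * r ^ 3))
    (h2 : b ≤ (1 - t) * a + t * s + L * r * (t * D) ^ 2 + L / 2 * (t * D) ^ 3) :
    b - s ≤ (1 - 5 / 7 * t) * (a - s) + 5 / 6 * (L * (t * D) ^ 3) := by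
  have hq : 0 ≤ t * D := mul_nonneg ht hD
  set q := t * D
  have : 0 ≤ L * ((r - q) ^ 2 * (r + 2 * q)) := by positivity
  nlinarith

lemma main_rec (δ : ℕ → ℝ) (K : ℝ) (hK : 0 ≤ K) (k : ℕ) (h1 : δ 1 ≤ 3 / 2 * K)
    (h : ∀ j ≤ k, ∀ t : ℝ, 0 ≤ t → t ≤ 1 →
      δ (j + 1) ≤ (1 - 5 / 7 * t) * δ j + 5 / 6 * (K * t ^ 3)) :
    ∀ j ≤ k, δ (j + 1) ≤ 62 * K / ((j : ℝ) + 5) ^ 2 := by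
  intro j
  induction j with
  | zero => intro _; norm_num; linarith
  | succ j ih =>
    intro hj
    have i := ih (by omega)
    have hn : (5 : ℝ) ≤ (j : ℝ) + 5 := by linarith [Nat.cast_nonneg (α := ℝ) j]
    have e : ((j + 1 : ℕ) : ℝ) + 5 = ((j : ℝ) + 5) + 1 := by push_cast; ring
    rw [e]
    set n : ℝ := (j : ℝ) + 5
    have hn0 : 0 < n := by linarith
    have s := h (j + 1) hj (21 / 5 / n) (by positivity) (by rw [div_le_one hn0]; linarith)
    have hc : (0 : ℝ) ≤ 1 - 5 / 7 * (21 / 5 / n) := by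
      have : 21 / 5 / n ≤ 1 := by rw [div_le_one hn0]; linarith
      linarith
    have := mul_le_mul_of_nonneg_left i hc
    refine (s.trans (add_le_add_left this _)).trans ?_
    have key : (1 - 5 / 7 * (21 / 5 / n)) * (62 / n ^ 2) + 5 / 6 * (21 / 5 / n) ^ 3
        ≤ 62 / (n + 1) ^ 2 := by
      have : (1 - 5 / 7 * (21 / 5 / n)) * (62 / n ^ 2) + 5 / 6 * (21 / 5 / n) ^ 3
        = (62 * n - 124.26) / n ^ 3 := by field_simp; ring
      rw [this, div_le_div_iff₀ (by positivity) (by positivity)]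
      nlinarith [mul_pos hn0 hn0]
    calc _ = ((1 - 5 / 7 * (21 / 5 / n)) * (62 / n ^ 2) + 5 / 6 * (21 / 5 / n) ^ 3) * K := by ring
      _ ≤ 62 / (n + 1) ^ 2 * K := mul_le_mul_of_nonneg_right key hK
      _ = _ := by ring

end CEQN

/-- `O(1/k²)` rate of CEQN under controllable inexactness
`α_j ≤ L ‖x_{j+1} − x_j‖_{B_j}`. -/
theorem stmt9 {d : ℕ} (f : EuclideanSpace ℝ (Fin d) → ℝ)
    (hconv : ConvexOn ℝ Set.univ f) (hC2 : ContDiff ℝ 2 f)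
    (hpd : ∀ x, (hessM f x).PosDef)
    (Ls : ℝ) (hLs : 0 < Ls) (hssc : SemiStrongSelfConcordant f Ls)
    (xs : EuclideanSpace ℝ (Fin d)) (hmin : ∀ y, f xs ≤ f y)
    (al au L : ℝ) (hL : (1 + au) ^ ((3 : ℝ) / 2) * Ls ≤ L)
    (x : ℕ → EuclideanSpace ℝ (Fin d)) (B : ℕ → Matrix (Fin d) (Fin d) ℝ)
    (α η : ℕ → ℝ)
    (hrel : ∀ j, RelInexactHessian f (x j) al au (B j))
    (hα : ∀ j, 0 < α j ∧ max al au ≤ α j)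
    (hη : ∀ j, 0 < η j ∧
      L * η j ^ 2 * dualNormB (B j) (gradient f (x j)) + (1 + α j) * η j = 1)
    (hstep : ∀ j, x (j + 1) = x j - η j • mulV (B j)⁻¹ (gradient f (x j)))
    (k : ℕ) (hk : 1 ≤ k)
    (hctrl : ∀ j ≤ k, α j ≤ L * normB (B j) (x (j + 1) - x j))
    (Db : ℝ) (hDb : 0 < Db)
    (hD : ∀ j ≤ k + 1, normB (B j) (x j - xs) + dualNormB (B j) (gradient f (x j)) ≤ Db) :
    f (x (k + 1)) - f xs ≤ 486 * L * Db ^ 3 / (k : ℝ) ^ 2 := by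
  have hau : 0 ≤ au := (hrel 0).2.2.1
  have hL0 : 0 ≤ L := le_trans (by positivity) hL
  have hs := fun j (hj : j ≤ k) => CEQN.step f hC2 hconv hpd Ls hLs hssc al au L hL hL0 (x j) xs
    (x (j + 1)) (B j) (hrel j) (α j) (η j) (hα j) (hη j) (hstep j) (hctrl j hj) Db
    (hD j (by omega))
  have hmain := CEQN.main_rec (fun j => f (x j) - f xs) (L * Db ^ 3) (by positivity) k
    (by
      obtain ⟨r, hr0, hrD, -, h⟩ := hs 0 (Nat.zero_le _)
      have h := h 1 zero_le_one le_rfl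
      have : L * r * Db ^ 2 ≤ L * Db * Db ^ 2 := by gcongr
      simp only [zero_add] at h ⊢
      nlinarith)
    (by
      intro j hj t ht0 ht1
      obtain ⟨r, hr0, hrD, h1, h⟩ := hs j hj
      have := CEQN.comb _ _ _ _ _ _ _ hL0 hr0 hDb.le ht0 h1 (h t ht0 ht1)
      refine this.trans (le_of_eq ?_)
      ring) k le_rfl
  have hk0 : (0 : ℝ) < k := by exact_mod_cast hk
  refine hmain.trans ?_
  have : 0 ≤ L * Db ^ 3 := by positivity
  calc 62 * (L * Db ^ 3) / ((k : ℝ) + 5) ^ 2 ≤ 62 * (L * Db ^ 3) / (k : ℝ) ^ 2 := by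
        gcongr; linarith
    _ ≤ _ := by
        apply div_le_div_of_nonneg_right _ (by positivity)
        linarith
end

section
/- Let f : ℝ^d → ℝ be convex and differentiable with a global minimizer x*, let x_k, x_{k+1} ∈ ℝ^d, let B_k be a symmetric positive definite d×d matrix, and let L, θ, R > 0 satisfy ‖x_k − x*‖_{B_k} ≤ R. If f(x_{k+1}) − f(x_k) ≤ −(1/√(8Lθ)) (‖∇f(x_k)‖_{B_k}^*)^{3/2}, then f(x_{k+1}) − f(x_k) ≤ −(1/√(8 L θ R³)) (f(x_k) − f(x*))^{3/2}. -/
open scoped RealInnerProductSpace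

theorem cs_dot {d : ℕ} (B : Matrix (Fin d) (Fin d) ℝ) (hB : B.PosDef) (g h : Fin d → ℝ) :
    (g ⬝ᵥ h) ^ 2 ≤ (g ⬝ᵥ B⁻¹.mulVec g) * (h ⬝ᵥ B.mulVec h) := by
  have hdet : IsUnit B.det := hB.det_pos.ne'.isUnit
  have hBu : B.mulVec (B⁻¹.mulVec g) = g := by
    rw [Matrix.mulVec_mulVec, Matrix.mul_nonsing_inv _ hdet, Matrix.one_mulVec]
  set u := B⁻¹.mulVec g with hu
  have hT : B.transpose = B := by
    have := hB.1
    rwa [Matrix.IsHermitian, Matrix.conjTranspose_eq_transpose_of_trivial] at this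
  have hsym : u ⬝ᵥ B.mulVec h = g ⬝ᵥ h := by
    rw [Matrix.dotProduct_mulVec, ← Matrix.mulVec_transpose, hT, hBu]
  have key : ∀ t : ℝ, 0 ≤ (g ⬝ᵥ u) * (t * t) + (2 * (g ⬝ᵥ h)) * t + h ⬝ᵥ B.mulVec h := by
    intro t
    have h0 := hB.posSemidef.dotProduct_mulVec_nonneg (h + t • u)
    have e : star (h + t • u) = h + t • u := by simp
    rw [e, Matrix.mulVec_add, Matrix.mulVec_smul, hBu] at h0
    simp only [add_dotProduct, dotProduct_add, smul_dotProduct, dotProduct_smul, hsym,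
      smul_eq_mul, dotProduct_comm h g, dotProduct_comm u g] at h0
    linarith
  have := discrim_le_zero key
  rw [discrim] at this
  nlinarith

theorem cs_norm {d : ℕ} (B : Matrix (Fin d) (Fin d) ℝ) (hB : B.PosDef)
    (g h : EuclideanSpace ℝ (Fin d)) :
    ⟪g, h⟫ ≤ dualNormB B g * normB B h := by
  have e : ∀ x y : EuclideanSpace ℝ (Fin d), ⟪x, y⟫ = x.ofLp ⬝ᵥ y.ofLp := by
    intro x y
    rw [EuclideanSpace.inner_eq_star_dotProduct, dotProduct_comm]
    simp
  have h1 := cs_dot B hB g.ofLp h.ofLp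
  have h2 : 0 ≤ g.ofLp ⬝ᵥ B⁻¹.mulVec g.ofLp := by
    simpa using hB.inv.posSemidef.dotProduct_mulVec_nonneg g.ofLp
  have m : ∀ (A : Matrix (Fin d) (Fin d) ℝ) (v : EuclideanSpace ℝ (Fin d)),
      (mulV A v).ofLp = A.mulVec v.ofLp := fun _ _ => rfl
  rw [dualNormB, normB, e, e, e, m, m, ← Real.sqrt_mul h2]
  exact Real.le_sqrt_of_sq_le h1

theorem first_order {d : ℕ} (f : EuclideanSpace ℝ (Fin d) → ℝ)
    (hconv : ConvexOn ℝ Set.univ f) (hdiff : Differentiable ℝ f)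
    (x y : EuclideanSpace ℝ (Fin d)) : f x - f y ≤ ⟪gradient f x, x - y⟫ := by
  have hc := hconv.comp_affineMap (AffineMap.lineMap (k := ℝ) x y)
  have hd : HasDerivAt (f ∘ (AffineMap.lineMap (k := ℝ) x y)) (fderiv ℝ f x (y - x)) 0 := by
    apply HasFDerivAt.comp_hasDerivAt
    · simpa using (hdiff x).hasFDerivAt
    · exact AffineMap.hasDerivAt_lineMap
  have := hc.le_slope_of_hasDerivAt (x := 0) (y := 1) (by simp) (by simp) one_pos hd
  rw [slope_def_field] at this
  simp only [Function.comp, AffineMap.lineMap_apply_zero, AffineMap.lineMap_apply_one] at this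
  rw [inner_gradient_left, ← neg_sub y x, map_neg]
  linarith

/-- converting a dual-gradient-norm decrease into a function-gap decrease. -/
theorem stmt12 {d : ℕ} (f : EuclideanSpace ℝ (Fin d) → ℝ)
    (hconv : ConvexOn ℝ Set.univ f) (hdiff : Differentiable ℝ f)
    (xs : EuclideanSpace ℝ (Fin d)) (hmin : ∀ y, f xs ≤ f y)
    (xk xk1 : EuclideanSpace ℝ (Fin d)) (Bk : Matrix (Fin d) (Fin d) ℝ) (hBk : Bk.PosDef)
    (L θ R : ℝ) (hL : 0 < L) (hθ : 0 < θ) (hR : 0 < R)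
    (hdist : normB Bk (xk - xs) ≤ R)
    (hdec : f xk1 - f xk ≤
      -(1 / Real.sqrt (8 * L * θ)) * (dualNormB Bk (gradient f xk)) ^ ((3 : ℝ) / 2)) :
    f xk1 - f xk ≤ -(1 / Real.sqrt (8 * L * θ * R ^ 3)) * (f xk - f xs) ^ ((3 : ℝ) / 2) := by
  have hgap : 0 ≤ f xk - f xs := sub_nonneg.2 (hmin xk)
  have hG : 0 ≤ dualNormB Bk (gradient f xk) := Real.sqrt_nonneg _
  have h1 : f xk - f xs ≤ dualNormB Bk (gradient f xk) * R :=
    ((first_order f hconv hdiff xk xs).trans (cs_norm Bk hBk _ _)).trans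
      (mul_le_mul_of_nonneg_left hdist hG)
  refine hdec.trans ?_
  have h2 := Real.rpow_le_rpow hgap h1 (by norm_num : (0 : ℝ) ≤ 3 / 2)
  rw [Real.mul_rpow hG hR.le] at h2
  have h3 : Real.sqrt (R ^ 3) = R ^ ((3 : ℝ) / 2) := by
    rw [Real.sqrt_eq_rpow, ← Real.rpow_natCast, ← Real.rpow_mul hR.le]
    norm_num
  have hS : 0 < Real.sqrt (8 * L * θ) := Real.sqrt_pos.2 (by positivity)
  have hRp : 0 < R ^ ((3 : ℝ) / 2) := Real.rpow_pos_of_pos hR _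
  rw [Real.sqrt_mul (by positivity : 0 ≤ 8 * L * θ) (R ^ 3), h3, neg_mul, neg_mul, neg_le_neg_iff, one_div_mul_eq_div,
    one_div_mul_eq_div, div_le_div_iff₀ (by positivity) hS]
  nlinarith [mul_le_mul_of_nonneg_left h2 hS.le]
end
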